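/- For α,β > -1, α ≠ β, sgn α = sgn β, set b = (β+α)/(β-α) and define the X_1-Jacobi polynomial P̂_n^{(α,β)} = -(1/2)(x-b) P_{n-1}^{(α,β)} + (b P_{n-1}^{(α,β)} - P_{n-2}^{(α,β)})/(α+β+2n-2) for n ≥ 1 (with P_{-1}^{(α,β)} = 0). Then for m ≠ n (m,n ≥ 1), ∫_{-1}^1 P̂_m^{(α,β)}(x) P̂_n^{(α,β)}(x) (1-x)^α (1+x)^β (x-b)^{-2} dx = 0. -/

import Mathlib

open MeasureTheory Polynomial

/-- Classical Jacobi polynomials P_n^{(α,β)}, defined by the standard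
three-term recurrence. -/
noncomputable def jacobiP (α β : ℝ) : ℕ → Polynomial ℝ
  | 0 => 1
  | 1 => Polynomial.C ((α + β + 2) / 2) * Polynomial.X + Polynomial.C ((α - β) / 2)
  | n + 2 =>
      Polynomial.C (1 / (2 * ((n : ℝ) + 2) * ((n : ℝ) + 2 + α + β) *
          (2 * ((n : ℝ) + 2) + α + β - 2))) *
        (Polynomial.C (2 * ((n : ℝ) + 2) + α + β - 1) *
            (Polynomial.C ((2 * ((n : ℝ) + 2) + α + β) *
                (2 * ((n : ℝ) + 2) + α + β - 2)) * Polynomial.X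
              + Polynomial.C (α ^ 2 - β ^ 2)) * jacobiP α β (n + 1)
          - Polynomial.C (2 * ((n : ℝ) + 2 + α - 1) * ((n : ℝ) + 2 + β - 1) *
              (2 * ((n : ℝ) + 2) + α + β)) * jacobiP α β n)

/-- X₁-Jacobi polynomial
P̂_n^{(α,β)} = -(1/2)(x-b) P_{n-1}^{(α,β)} + (b P_{n-1}^{(α,β)} - P_{n-2}^{(α,β)})/(α+β+2n-2)
for n ≥ 1, with the convention P_{-1}^{(α,β)} = 0. -/
noncomputable def hatP (α β b : ℝ) (n : ℕ) : Polynomial ℝ :=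
  Polynomial.C (-(1 / 2)) * (Polynomial.X - Polynomial.C b) * jacobiP α β (n - 1)
    + Polynomial.C (1 / (α + β + 2 * (n : ℝ) - 2)) *
        (Polynomial.C b * jacobiP α β (n - 1)
          - if 2 ≤ n then jacobiP α β (n - 2) else 0)

/-- The Jacobi polynomial of degree `k - 1`, with the convention `P_{-1} = 0`. -/
noncomputable def jacobiPred (α β : ℝ) : ℕ → Polynomial ℝ
  | 0 => 0
  | k + 1 => jacobiP α β k

/-- The three-term recurrence with denominators cleared. -/
lemma jacobiP_recurrence {α β : ℝ} (hσ : 0 < α + β + 2) (k : ℕ) (x : ℝ) :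
    2 * ((k : ℝ) + 2) * (k + 2 + α + β) * (2 * (k + 2) + α + β - 2) *
        (jacobiP α β (k + 2)).eval x =
      (2 * ((k : ℝ) + 2) + α + β - 1) *
          ((2 * (k + 2) + α + β) * (2 * (k + 2) + α + β - 2) * x + (α ^ 2 - β ^ 2)) *
          (jacobiP α β (k + 1)).eval x
        - 2 * (k + 2 + α - 1) * (k + 2 + β - 1) * (2 * (k + 2) + α + β) *
          (jacobiP α β k).eval x := by
  have hk : (0 : ℝ) ≤ k := k.cast_nonneg
  have h1 : (k : ℝ) + 2 ≠ 0 := by positivity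
  have h2 : (k : ℝ) + 2 + α + β ≠ 0 := by linarith
  have h3 : 2 * ((k : ℝ) + 2) + α + β - 2 ≠ 0 := by linarith
  simp only [jacobiP, eval_mul, eval_add, eval_sub, eval_C, eval_X]
  field_simp

/-- The differentiated three-term recurrence with denominators cleared. -/
lemma jacobiP_derivative_recurrence {α β : ℝ} (hσ : 0 < α + β + 2) (k : ℕ) (x : ℝ) :
    2 * ((k : ℝ) + 2) * (k + 2 + α + β) * (2 * (k + 2) + α + β - 2) *
        (derivative (jacobiP α β (k + 2))).eval x =
      (2 * ((k : ℝ) + 2) + α + β - 1) *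
          ((2 * (k + 2) + α + β) * (2 * (k + 2) + α + β - 2) * x + (α ^ 2 - β ^ 2)) *
          (derivative (jacobiP α β (k + 1))).eval x
        + (2 * ((k : ℝ) + 2) + α + β - 1) *
          ((2 * (k + 2) + α + β) * (2 * (k + 2) + α + β - 2)) *
          (jacobiP α β (k + 1)).eval x
        - 2 * (k + 2 + α - 1) * (k + 2 + β - 1) * (2 * (k + 2) + α + β) *
          (derivative (jacobiP α β k)).eval x := by
  have hk : (0 : ℝ) ≤ k := k.cast_nonneg
  have h1 : (k : ℝ) + 2 ≠ 0 := by positivity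
  have h2 : (k : ℝ) + 2 + α + β ≠ 0 := by linarith
  have h3 : 2 * ((k : ℝ) + 2) + α + β - 2 ≠ 0 := by linarith
  simp only [jacobiP, derivative_mul, derivative_add, derivative_sub, derivative_C, derivative_X,
    eval_mul, eval_add, eval_sub, eval_C, eval_X, eval_zero, eval_one]
  field_simp
  ring

/-- The two first-order structure relations of consecutive Jacobi polynomials. -/
lemma jacobiP_structure_succ {α β : ℝ} (hσ : 0 < α + β + 2) (k : ℕ) (x : ℝ) :
    (2 * ((k : ℝ) + 1) + α + β) * (1 - x ^ 2) * (derivative (jacobiP α β (k + 1))).eval x =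
        (k + 1) * (α - β - (2 * (k + 1) + α + β) * x) * (jacobiP α β (k + 1)).eval x
          + 2 * (k + 1 + α) * (k + 1 + β) * (jacobiP α β k).eval x ∧
      (2 * ((k : ℝ) + 1) + α + β) * (1 - x ^ 2) * (derivative (jacobiP α β k)).eval x =
        (k + 1 + α + β) * (α - β + (2 * (k + 1) + α + β) * x) * (jacobiP α β k).eval x
          - 2 * (k + 1) * (k + 1 + α + β) * (jacobiP α β (k + 1)).eval x := by
  induction k with
  | zero =>
    simp [jacobiP]
    constructor <;> ring
  | succ k ih =>
    obtain ⟨hA, hB⟩ := ih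
    have hk : (0 : ℝ) ≤ k := k.cast_nonneg
    have h1 : (k : ℝ) + 2 ≠ 0 := by positivity
    have h2 : (k : ℝ) + 2 + α + β ≠ 0 := by linarith
    have h3 : 2 * ((k : ℝ) + 2) + α + β - 2 ≠ 0 := by linarith
    have hr := jacobiP_recurrence hσ k x
    have hd := jacobiP_derivative_recurrence hσ k x
    push_cast
    have hB' : (2 * ((k : ℝ) + 1 + 1) + α + β) * (1 - x ^ 2) *
          (derivative (jacobiP α β (k + 1))).eval x =
        (k + 1 + 1 + α + β) * (α - β + (2 * (k + 1 + 1) + α + β) * x) *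
            (jacobiP α β (k + 1)).eval x
          - 2 * (k + 1 + 1) * (k + 1 + 1 + α + β) * (jacobiP α β (k + 2)).eval x := by
      apply mul_left_cancel₀ h3
      linear_combination (2 * ((k : ℝ) + 2) + α + β) * hA + hr
    refine ⟨?_, hB'⟩
    apply mul_left_cancel₀ (mul_ne_zero h3
      (mul_ne_zero (mul_ne_zero (mul_ne_zero two_ne_zero h1) h2) h3))
    generalize (derivative (jacobiP α β (k + 1 + 1))).eval x = w' at *
    generalize (derivative (jacobiP α β (k + 1))).eval x = u' at *
    generalize (derivative (jacobiP α β k)).eval x = v' at *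
    generalize (jacobiP α β (k + 1 + 1)).eval x = w at *
    generalize (jacobiP α β (k + 1)).eval x = u at *
    generalize (jacobiP α β k).eval x = v at *
    linear_combination
      (2 * ((k : ℝ) + 2) + α + β - 2) * (2 * ((k : ℝ) + 2) + α + β) * (1 - x ^ 2) * hd
      + (2 * ((k : ℝ) + 2) + α + β) * (2 * ((k : ℝ) + 2) + α + β - 1) *
          ((2 * (k + 2) + α + β) * (2 * (k + 2) + α + β - 2) * x + (α ^ 2 - β ^ 2)) * hA
      - (2 * ((k : ℝ) + 2) + α + β) * 2 * (k + 2 + α - 1) * (k + 2 + β - 1) *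
          (2 * (k + 2) + α + β) * hB
      - (2 * ((k : ℝ) + 2) + α + β - 2) * ((k + 2) * (α - β - (2 * (k + 2) + α + β) * x)) * hr

/-- The structure relations, including the degenerate case `k = 0`. -/
lemma jacobiP_structure {α β : ℝ} (hσ : 0 < α + β + 2) (k : ℕ) (x : ℝ) :
    (2 * (k : ℝ) + α + β) * (1 - x ^ 2) * (derivative (jacobiP α β k)).eval x =
        k * (α - β - (2 * k + α + β) * x) * (jacobiP α β k).eval x
          + 2 * (k + α) * (k + β) * (jacobiPred α β k).eval x ∧
      (2 * (k : ℝ) + α + β) * (1 - x ^ 2) * (derivative (jacobiPred α β k)).eval x =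
        (k + α + β) * (α - β + (2 * k + α + β) * x) * (jacobiPred α β k).eval x
          - 2 * k * (k + α + β) * (jacobiP α β k).eval x := by
  cases k with
  | zero => simp [jacobiP, jacobiPred]
  | succ k => simpa [jacobiPred] using jacobiP_structure_succ hσ k x

/-- The structure relations differentiated once. -/
lemma jacobiP_structure_derivative {α β : ℝ} (hσ : 0 < α + β + 2) (k : ℕ) (x : ℝ) :
    (2 * (k : ℝ) + α + β) * ((1 - x ^ 2) * (derivative (derivative (jacobiP α β k))).eval x
          - 2 * x * (derivative (jacobiP α β k)).eval x) =
        k * (α - β - (2 * k + α + β) * x) * (derivative (jacobiP α β k)).eval x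
          - k * (2 * k + α + β) * (jacobiP α β k).eval x
          + 2 * (k + α) * (k + β) * (derivative (jacobiPred α β k)).eval x ∧
      (2 * (k : ℝ) + α + β) * ((1 - x ^ 2) * (derivative (derivative (jacobiPred α β k))).eval x
          - 2 * x * (derivative (jacobiPred α β k)).eval x) =
        (k + α + β) * (α - β + (2 * k + α + β) * x) * (derivative (jacobiPred α β k)).eval x
          + (k + α + β) * (2 * k + α + β) * (jacobiPred α β k).eval x
          - 2 * k * (k + α + β) * (derivative (jacobiP α β k)).eval x := by
  have hA : C (2 * (k : ℝ) + α + β) * (1 - X ^ 2) * derivative (jacobiP α β k) =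
      C (k : ℝ) * (C (α - β) - C (2 * (k : ℝ) + α + β) * X) * jacobiP α β k
        + C (2 * ((k : ℝ) + α) * (k + β)) * jacobiPred α β k := by
    refine Polynomial.funext fun y => ?_
    simpa only [eval_mul, eval_add, eval_sub, eval_C, eval_X, eval_pow, eval_one]
      using (jacobiP_structure hσ k y).1
  have hB : C (2 * (k : ℝ) + α + β) * (1 - X ^ 2) * derivative (jacobiPred α β k) =
      C ((k : ℝ) + α + β) * (C (α - β) + C (2 * (k : ℝ) + α + β) * X) * jacobiPred α β k
        - C (2 * (k : ℝ) * (k + α + β)) * jacobiP α β k := by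
    refine Polynomial.funext fun y => ?_
    simpa only [eval_mul, eval_add, eval_sub, eval_C, eval_X, eval_pow, eval_one]
      using (jacobiP_structure hσ k y).2
  have hA' := congrArg (fun p => (derivative p).eval x) hA
  have hB' := congrArg (fun p => (derivative p).eval x) hB
  simp only [derivative_mul, derivative_add, derivative_sub, derivative_C, derivative_X,
    derivative_one, derivative_X_pow, eval_mul, eval_add, eval_sub, eval_C, eval_X, eval_pow,
    eval_zero, eval_one] at hA' hB'
  norm_num at hA' hB'
  exact ⟨by linear_combination hA', by linear_combination hB'⟩

lemma hatP_succ (α β b : ℝ) (k : ℕ) :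
    hatP α β b (k + 1) = C (-(1 / 2)) * (X - C b) * jacobiP α β k
      + C (1 / (2 * (k : ℝ) + α + β)) * (C b * jacobiP α β k - jacobiPred α β k) := by
  have h : α + β + 2 * ((k + 1 : ℕ) : ℝ) - 2 = 2 * (k : ℝ) + α + β := by push_cast; ring
  unfold hatP
  rw [h]
  cases k <;> simp [jacobiPred]

/-- The second-order differential equation of the `X₁`-Jacobi polynomials. -/
lemma hatP_ode {α β b : ℝ} (hσ : 0 < α + β + 2) (hσ0 : α + β ≠ 0)
    (hb : b * (β - α) = β + α) (k : ℕ) {x : ℝ} (hx : 1 - x ^ 2 ≠ 0) :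
    (x - b) * (1 - x ^ 2) * (derivative (derivative (hatP α β b (k + 1)))).eval x
      + (1 - b * x) * ((β - α) * x - (α + β + 2)) * (derivative (hatP α β b (k + 1))).eval x
      + (k * (k + 1 + α + β) * (x - b) - (β - α) * (1 - b * x)) * (hatP α β b (k + 1)).eval x
      = 0 := by
  have hK : 2 * (k : ℝ) + α + β ≠ 0 := by
    rcases k.eq_zero_or_pos with rfl | hk
    · simpa using hσ0
    · have : (1 : ℝ) ≤ k := by exact_mod_cast hk
      linarith
  obtain ⟨hA, hB⟩ := jacobiP_structure hσ k x
  obtain ⟨hA', hB'⟩ := jacobiP_structure_derivative hσ k x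
  rw [hatP_succ]
  simp only [derivative_mul, derivative_add, derivative_sub, derivative_C, derivative_X,
    eval_mul, eval_add, eval_sub, eval_C, eval_X, eval_zero, eval_one, derivative_zero,
    derivative_one]
  generalize (derivative (derivative (jacobiP α β k))).eval x = u'' at *
  generalize (derivative (derivative (jacobiPred α β k))).eval x = v'' at *
  generalize (derivative (jacobiP α β k)).eval x = u' at *
  generalize (derivative (jacobiPred α β k)).eval x = v' at *
  generalize (jacobiP α β k).eval x = u at *
  generalize (jacobiPred α β k).eval x = v at *
  generalize (k : ℝ) = κ at *
  obtain ⟨d, rfl⟩ : ∃ d, β = α + d := ⟨β - α, by ring⟩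
  obtain rfl : α = d * (b - 1) / 2 := by linear_combination -hb / 2
  have hK' : 2 * κ + b * d ≠ 0 := by convert hK using 1; ring
  have hinv : 1 / (2 * κ + d * (b - 1) / 2 + (d * (b - 1) / 2 + d)) = 1 / (2 * κ + b * d) := by
    congr 1; ring
  rw [hinv]
  set K := 2 * κ + b * d with hKdef
  have hi : K * (1 / K) = 1 := by field_simp
  generalize 1 / K = i at *
  have key : K * (1 - x ^ 2) * ((x - b) * (1 - x ^ 2) *
        ((-K * (x - b) + 2 * b) * u'' - 2 * K * u' - 2 * v'')
      + (1 - b * x) * (d * x - b * d - 2) * ((-K * (x - b) + 2 * b) * u' - K * u - 2 * v')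
      + (κ * (κ + 1 + b * d) * (x - b) - d * (1 - b * x)) *
        ((-K * (x - b) + 2 * b) * u - 2 * v)) * K = 0 := by
    linear_combination K * ((1 - x ^ 2) * (x - b) * (-K * (x - b) + 2 * b) * hA'
        - 2 * (1 - x ^ 2) * (x - b) * hB')
      + ((x - b) * ((-K * (x - b) + 2 * b) * (2 * x * K - κ * (d + K * x))
          - 2 * (1 - x ^ 2) * K ^ 2 + 4 * κ * (κ + b * d))
          + K * ((1 - b * x) * (d * x - b * d - 2)) * (-K * (x - b) + 2 * b)) * hA
      + ((x - b) * ((-K * (x - b) + 2 * b) * (2 * (κ + d * (b - 1) / 2) * (κ + d * (b + 1) / 2))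
          - 4 * x * K - 2 * (κ + b * d) * (-d + K * x))
          - 2 * K * ((1 - b * x) * (d * x - b * d - 2))) * hB
  have key' := (mul_eq_zero.mp ((mul_eq_zero.mp key).resolve_right hK')).resolve_left
    (mul_ne_zero hK' hx)
  apply mul_left_cancel₀ (mul_ne_zero two_ne_zero hK')
  linear_combination key' + 2 * ((x - b) * (1 - x ^ 2) * (b * u'' - v'')
      + (1 - b * x) * (d * x - b * d - 2) * (b * u' - v')
      + (κ * (κ + 1 + b * d) * (x - b) - d * (1 - b * x)) * (b * u - v)) * hi

/-- The Wronskian form whose derivative is a multiple of the orthogonality integrand. -/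
lemma hasDerivAt_weighted_wronskian {α β b : ℝ} (y z : Polynomial ℝ) {x : ℝ}
    (hx : x ∈ Set.Ioo (-1 : ℝ) 1) (hxb : x - b ≠ 0) (hb : b * (β - α) = β + α) {l l' : ℝ}
    (hy : (x - b) * (1 - x ^ 2) * (derivative (derivative y)).eval x
      + (1 - b * x) * ((β - α) * x - (α + β + 2)) * (derivative y).eval x
      + (l * (x - b) - (β - α) * (1 - b * x)) * y.eval x = 0)
    (hz : (x - b) * (1 - x ^ 2) * (derivative (derivative z)).eval x
      + (1 - b * x) * ((β - α) * x - (α + β + 2)) * (derivative z).eval x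
      + (l' * (x - b) - (β - α) * (1 - b * x)) * z.eval x = 0) :
    HasDerivAt (fun x : ℝ => (1 - x) ^ (α + 1) * (1 + x) ^ (β + 1) * ((x - b) ^ 2)⁻¹ *
        ((derivative y).eval x * z.eval x - y.eval x * (derivative z).eval x))
      ((l' - l) * (y.eval x * z.eval x *
        ((1 - x) ^ α * (1 + x) ^ β * ((x - b) ^ 2)⁻¹))) x := by
  have hx1 : 0 < 1 - x := by linarith [hx.2]
  have hx2 : 0 < 1 + x := by linarith [hx.1]
  have d1 := ((hasDerivAt_id x).const_sub 1).rpow_const (p := α + 1) (Or.inl hx1.ne')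
  have d2 := ((hasDerivAt_id x).const_add 1).rpow_const (p := β + 1) (Or.inl hx2.ne')
  have d3 := (((hasDerivAt_id x).sub_const b).pow 2).inv (pow_ne_zero 2 hxb)
  have d4 := ((derivative y).hasDerivAt x).mul (z.hasDerivAt x)
  have d5 := (y.hasDerivAt x).mul ((derivative z).hasDerivAt x)
  refine (((d1.mul d2).mul d3).mul (d4.sub d5)).congr_deriv ?_
  simp only [id, Pi.mul_apply, Pi.sub_apply, Pi.pow_apply, Pi.inv_apply, add_sub_cancel_right,
    Real.rpow_add_one hx1.ne', Real.rpow_add_one hx2.ne']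
  generalize (1 - x) ^ α = p
  generalize (1 + x) ^ β = q
  generalize (derivative (derivative y)).eval x = y'' at *
  generalize (derivative (derivative z)).eval x = z'' at *
  generalize (derivative y).eval x = y' at *
  generalize (derivative z).eval x = z' at *
  generalize y.eval x = y at *
  generalize z.eval x = z at *
  field_simp
  linear_combination p * q * (x - b) * (z * hy - y * hz)
    + p * q * (x - b) * (x ^ 2 - 1) * (y' * z - y * z') * hb

lemma mul_pos_of_sign_eq {α β : ℝ} (hne : α ≠ β) (h : Real.sign α = Real.sign β) :
    0 < α * β := by
  rcases lt_trichotomy α 0 with hα | rfl | hα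
  · rw [Real.sign_of_neg hα] at h
    rcases lt_trichotomy β 0 with hβ | rfl | hβ
    · exact mul_pos_of_neg_of_neg hα hβ
    · norm_num at h
    · norm_num [Real.sign_of_pos hβ] at h
  · rw [Real.sign_zero] at h
    exact absurd (Real.sign_eq_zero_iff.mp h.symm).symm hne
  · rw [Real.sign_of_pos hα] at h
    rcases lt_trichotomy β 0 with hβ | rfl | hβ
    · norm_num [Real.sign_of_neg hβ] at h
    · norm_num at h
    · exact mul_pos hα hβ

/-- For α,β > -1, α ≠ β, sgn α = sgn β, b = (β+α)/(β-α), the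
X₁-Jacobi polynomials with m ≠ n (m,n ≥ 1) are orthogonal with respect to the
weight (1-x)^α (1+x)^β (x-b)^{-2} on (-1,1). -/
theorem stmt_17 (α β : ℝ) (hα : -1 < α) (hβ : -1 < β) (hne : α ≠ β)
    (hsgn : Real.sign α = Real.sign β) (b : ℝ) (hb : b = (β + α) / (β - α))
    (m n : ℕ) (hm : 1 ≤ m) (hn : 1 ≤ n) (hmn : m ≠ n) :
    ∫ x in Set.Ioo (-1 : ℝ) 1,
        (hatP α β b m).eval x * (hatP α β b n).eval x *
          ((1 - x) ^ α * (1 + x) ^ β * ((x - b) ^ 2)⁻¹) = 0 := by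
  have hαβ : 0 < α * β := mul_pos_of_sign_eq hne hsgn
  have hd : β - α ≠ 0 := sub_ne_zero.mpr hne.symm
  have hb' : b * (β - α) = β + α := by rw [hb]; field_simp
  have hσ : 0 < α + β + 2 := by linarith
  have hσ0 : α + β ≠ 0 := by
    intro h
    nlinarith [sq_nonneg α, eq_neg_of_add_eq_zero_right h]
  have hb1 : 1 < b ^ 2 := by
    have h1 : b ^ 2 * (β - α) ^ 2 = (β + α) ^ 2 := by rw [← hb']; ring
    have h2 : 0 < (β - α) ^ 2 := by positivity
    nlinarith
  have hxb : ∀ x ∈ Set.Icc (-1 : ℝ) 1, x - b ≠ 0 := by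
    intro x hx h
    obtain rfl : x = b := sub_eq_zero.mp h
    nlinarith [hx.1, hx.2]
  obtain ⟨j, rfl⟩ : ∃ j, m = j + 1 := ⟨m - 1, by omega⟩
  obtain ⟨k, rfl⟩ : ∃ k, n = k + 1 := ⟨n - 1, by omega⟩
  have hjk : (j : ℝ) ≠ k := by exact_mod_cast fun h => hmn (by rw [h])
  have hjk1 : (1 : ℝ) ≤ j + k := by
    have : 1 ≤ j + k := by omega
    exact_mod_cast this
  have hl : (k : ℝ) * (k + 1 + α + β) - j * (j + 1 + α + β) ≠ 0 := by
    have h : (k : ℝ) * (k + 1 + α + β) - j * (j + 1 + α + β)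
        = (k - j) * (j + k + 1 + α + β) := by ring
    rw [h]
    exact mul_ne_zero (sub_ne_zero.mpr hjk.symm) (by linarith)
  rw [← integral_Ioc_eq_integral_Ioo, ← intervalIntegral.integral_of_le (by norm_num)]
  -- If the integrand were not integrable, its integral would be zero by convention.
  by_cases hint : IntervalIntegrable (fun x : ℝ =>
      (hatP α β b (j + 1)).eval x * (hatP α β b (k + 1)).eval x *
        ((1 - x) ^ α * (1 + x) ^ β * ((x - b) ^ 2)⁻¹)) volume (-1) 1
  swap
  · exact intervalIntegral.integral_undef hint
  have hftc := intervalIntegral.integral_eq_sub_of_hasDerivAt_of_le (by norm_num) ?_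
    (fun x hx => by
      have hs : 1 - x ^ 2 ≠ 0 := by nlinarith [hx.1, hx.2]
      exact hasDerivAt_weighted_wronskian _ _ hx (hxb x (Set.Ioo_subset_Icc_self hx)) hb'
        (hatP_ode hσ hσ0 hb' j hs) (hatP_ode hσ hσ0 hb' k hs))
    (hint.const_mul _)
  · rw [intervalIntegral.integral_const_mul] at hftc
    refine (mul_eq_zero.mp (hftc.trans ?_)).resolve_left hl
    simp [Real.zero_rpow (show α + 1 ≠ 0 by linarith),
      Real.zero_rpow (show β + 1 ≠ 0 by linarith)]
  · have c1 : Continuous fun x : ℝ => (1 - x) ^ (α + 1) :=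
      (continuous_const.sub continuous_id).rpow_const fun _ => Or.inr (by linarith)
    have c2 : Continuous fun x : ℝ => (1 + x) ^ (β + 1) :=
      (continuous_const.add continuous_id).rpow_const fun _ => Or.inr (by linarith)
    have c3 : ContinuousOn (fun x : ℝ => ((x - b) ^ 2)⁻¹) (Set.Icc (-1) 1) :=
      ContinuousOn.inv₀ (by fun_prop) fun x hx => pow_ne_zero 2 (hxb x hx)
    exact ((c1.mul c2).continuousOn.mul c3).mul (by fun_prop)
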